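/- arXiv:2007.00960 — 2 statements merged into one kernel-verified Lean document; each statement's English description precedes it below -/
import Mathlib

section
/- Let Γ be an infinite virtually cyclic group acting freely by homeomorphisms on a nonempty compact Hausdorff space X whose covering dimension is finite. Then the dynamic asymptotic dimension of the action equals 1. -/
open Pointwise

/-- The set F(U,E): elements `g = gₙ⋯g₁` with each `gⱼ ∈ E` such that for some `x ∈ U`
all partial translates `gⱼ⋯g₁ • x` (j = 1,…,n) remain in `U`. -/
def dynF {Γ X : Type*} [Group Γ] [MulAction Γ X] (U : Set X) (E : Set Γ) : Set Γ :=
  {g | ∃ L : List Γ, L ≠ [] ∧ (∀ h ∈ L, h ∈ E) ∧ g = L.reverse.prod ∧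
    ∃ x ∈ U, ∀ j : ℕ, 1 ≤ j → j ≤ L.length → (L.take j).reverse.prod • x ∈ U}

/-- The marker property for an action. -/
def MarkerProperty (Γ X : Type*) [Group Γ] [MulAction Γ X] [TopologicalSpace X] : Prop :=
  ∀ F : Finset Γ, ∃ U : Set X, IsOpen U ∧
    (F : Set Γ).PairwiseDisjoint (fun g => g • U) ∧ (⋃ g : Γ, g • U) = Set.univ

/-- The dynamic asymptotic dimension is at most `d`. -/
def DadLE (Γ X : Type*) [Group Γ] [MulAction Γ X] [TopologicalSpace X] (d : ℕ) : Prop :=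
  ∀ E : Finset Γ, ∃ U : Fin (d + 1) → Set X, (∀ i, IsOpen (U i)) ∧
    (⋃ i, U i) = Set.univ ∧ ∀ i, (dynF (U i) (E : Set Γ)).Finite

/-- The dynamic asymptotic dimension, as an extended natural number (`⊤` if no `d` works). -/
noncomputable def dad (Γ X : Type*) [Group Γ] [MulAction Γ X] [TopologicalSpace X] : ℕ∞ :=
  sInf ((fun d : ℕ => (d : ℕ∞)) '' {d : ℕ | DadLE Γ X d})

/-- A group is virtually cyclic if it has a cyclic subgroup of finite index. -/
def IsVirtuallyCyclic (Γ : Type*) [Group Γ] : Prop :=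
  ∃ H : Subgroup Γ, IsCyclic H ∧ H.FiniteIndex

/-- The covering dimension of `X` is at most `n`: every open cover admits an open
refinement covering `X` in which every point belongs to at most `n+1` members. -/
def CovDimLE (X : Type*) [TopologicalSpace X] (n : ℕ) : Prop :=
  ∀ 𝒰 : Set (Set X), (∀ U ∈ 𝒰, IsOpen U) → ⋃₀ 𝒰 = Set.univ →
    ∃ 𝒱 : Set (Set X), (∀ V ∈ 𝒱, IsOpen V) ∧ ⋃₀ 𝒱 = Set.univ ∧
      (∀ V ∈ 𝒱, ∃ U ∈ 𝒰, V ⊆ U) ∧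
      ∀ x : X, ∃ s : Finset (Set X), {V ∈ 𝒱 | x ∈ V} ⊆ ↑s ∧ s.card ≤ n + 1

theorem exists_linearIndepOn_restrict_near {ι κ : Type*} [Fintype κ] (a : ι → κ → ℝ)
    {ε : ℝ} (hε : 0 < ε) (I : Finset ι) :
    ∃ b : ι → κ → ℝ, (∀ i, dist (b i) (a i) < ε) ∧ ∀ T ⊆ I, ∀ S : Finset κ, T.card ≤ S.card →
      LinearIndepOn ℝ (fun i => S.restrict (b i)) (T : Set ι) := by
  classical
  induction I using Finset.induction_on with
  | empty =>
    refine ⟨a, fun i => by simpa using hε, fun T hT S _ => ?_⟩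
    rw [Finset.subset_empty.mp hT]
    simp
  | insert i₀ I hi₀ ih =>
    obtain ⟨b, hb, hind⟩ := ih
    let W : Finset ι × Finset κ → Submodule ℝ (κ → ℝ) := fun p =>
      (Submodule.span ℝ ((fun i => p.2.restrict (b i)) '' (p.1 : Set ι))).comap
        (LinearMap.funLeft ℝ ℝ (fun j : p.2 => (j : κ)))
    have hW : ∀ p : Finset ι × Finset κ, p.1.card < p.2.card → W p ≠ ⊤ := by
      rintro ⟨T, S⟩ hlt htop
      have hsurj : Function.Surjective (LinearMap.funLeft ℝ ℝ (fun j : S => (j : κ))) :=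
        LinearMap.funLeft_surjective_of_injective _ _ _ Subtype.val_injective
      have hspan : Submodule.span ℝ ((fun i => S.restrict (b i)) '' (T : Set ι)) = ⊤ := by
        rw [eq_top_iff]
        rintro y -
        obtain ⟨x, rfl⟩ := hsurj y
        have : x ∈ W (T, S) := htop ▸ Submodule.mem_top
        exact this
      have h1 := finrank_span_finset_le_card (R := ℝ) (T.image fun i => S.restrict (b i))
      rw [Finset.coe_image, Set.finrank, hspan, finrank_top, Module.finrank_fintype_fun_eq_card,
        Fintype.card_coe] at h1
      exact absurd (h1.trans Finset.card_image_le) (not_le.mpr hlt)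
    let A : Finset (Finset ι × Finset κ) :=
      (I.powerset ×ˢ Finset.univ).filter fun p => p.1.card < p.2.card
    have hdense : Dense (⋂ p ∈ (A : Set (Finset ι × Finset κ)), ((W p : Set (κ → ℝ))ᶜ)) := by
      refine dense_biInter_of_isOpen (fun p _ => ?_) A.countable_toSet fun p hp => ?_
      · exact (Submodule.closed_of_finiteDimensional _).isOpen_compl
      · have := hW p (Finset.mem_filter.mp hp).2
        rw [← interior_eq_empty_iff_dense_compl, ← Set.not_nonempty_iff_eq_empty]
        exact fun h => this (Submodule.eq_top_of_nonempty_interior' _ h)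
    obtain ⟨c, hc, hcd⟩ := hdense.exists_dist_lt (a i₀) hε
    refine ⟨Function.update b i₀ c, fun i => ?_, fun T hT S hTS => ?_⟩
    · by_cases h : i = i₀
      · subst h; simpa [dist_comm] using hcd
      · simpa [h] using hb i
    · have hcongr : ∀ T' ⊆ I, Set.EqOn (fun i => S.restrict (b i))
          (fun i => S.restrict (Function.update b i₀ c i)) (T' : Set ι) := by
        intro T' hT' i hi
        have : i ≠ i₀ := fun h => hi₀ (h ▸ hT' hi)
        simp [this]
      by_cases hmem : i₀ ∈ T
      · have hsub : T.erase i₀ ⊆ I := fun i hi => by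
          obtain ⟨h1, h2⟩ := Finset.mem_erase.mp hi
          exact (Finset.mem_insert.mp (hT h2)).resolve_left h1
        have hlt : (T.erase i₀).card < S.card :=
          (Finset.card_erase_lt_of_mem hmem).trans_le hTS
        rw [← Finset.insert_erase hmem, Finset.coe_insert]
        refine LinearIndepOn.insert
          ((hind _ hsub S hlt.le).congr (hcongr _ hsub)) ?_
        rw [← (hcongr _ hsub).image_eq]
        have := Set.mem_iInter₂.mp hc (T.erase i₀, S) (by simp [A, hsub, hlt])
        simp only [Function.update_self]
        exact this
      · have hsub : T ⊆ I := fun i hi =>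
          (Finset.mem_insert.mp (hT hi)).resolve_left fun h => hmem (h ▸ hi)
        exact (hind T hsub S hTS).congr (hcongr T hsub)

theorem CovDimLE.exists_near_few_zeros {X κ : Type*} [TopologicalSpace X] [CompactSpace X]
    [T2Space X] [Fintype κ] {n : ℕ} (hX : CovDimLE X n) {v : X → κ → ℝ} (hv : Continuous v)
    {ε : ℝ} (hε : 0 < ε) :
    ∃ w : X → κ → ℝ, Continuous w ∧ (∀ x, dist (w x) (v x) ≤ ε) ∧
      ∀ x, ∀ S : Finset κ, S.card = n + 1 → ∃ k ∈ S, w x k ≠ 0 := by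
  classical
  obtain ⟨𝒱, h𝒱o, h𝒱c, h𝒱r, h𝒱n⟩ := hX (Set.range fun x => v ⁻¹' Metric.ball (v x) (ε / 4))
    (by rintro _ ⟨x, rfl⟩; exact Metric.isOpen_ball.preimage hv)
    (Set.eq_univ_of_forall fun x => ⟨_, ⟨x, rfl⟩, by simpa using hε⟩)
  obtain ⟨t, ht⟩ := isCompact_univ.elim_finite_subcover (fun V : 𝒱 => (V : Set X))
    (fun V => h𝒱o V V.2) (by rw [← Set.sUnion_eq_iUnion, h𝒱c])
  let U : t → Set X := fun i => ((i : 𝒱) : Set X)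
  have hcov : Set.univ ⊆ ⋃ i, U i := fun x hx => by
    obtain ⟨V, hV, hxV⟩ := Set.mem_iUnion₂.mp (ht hx)
    exact Set.mem_iUnion.mpr ⟨⟨V, hV⟩, hxV⟩
  obtain ⟨ρ, hρ⟩ := PartitionOfUnity.exists_isSubordinate isClosed_univ U
    (fun i => h𝒱o _ i.1.2) hcov
  have hρU : ∀ i x, ρ i x ≠ 0 → x ∈ U i := fun i x hx => hρ i (subset_tsupport _ hx)
  have hc : ∀ i : t, ∃ c : κ → ℝ, ∀ x ∈ U i, dist c (v x) < ε / 4 := fun i => by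
    obtain ⟨_, ⟨y, rfl⟩, hy⟩ := h𝒱r _ i.1.2
    exact ⟨v y, fun x hx => by simpa [dist_comm] using hy hx⟩
  choose a ha using hc
  obtain ⟨b, hb, hind⟩ := exists_linearIndepOn_restrict_near a (half_pos hε) Finset.univ
  have hsum : ∀ x, ∑ i, ρ i x = 1 := fun x => by
    rw [← finsum_eq_sum_of_fintype]; exact ρ.sum_eq_one (Set.mem_univ x)
  refine ⟨fun x => ∑ i, ρ i x • b i, ?_, fun x => ?_, fun x S hS => ?_⟩
  · fun_prop
  · have := ρ.finsum_smul_mem_convex (g := fun i _ => b i) (Set.mem_univ x)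
      (t := Metric.closedBall (v x) ε) (fun i hi => ?_) (convex_closedBall _ _)
    · rwa [finsum_eq_sum_of_fintype] at this
    · have h1 := ha i x (hρU i x hi)
      have h2 := hb i
      have h3 := dist_triangle (b i) (a i) (v x)
      rw [Metric.mem_closedBall]
      linarith
  · by_contra! hzero
    let T : Finset t := Finset.univ.filter fun i => ρ i x ≠ 0
    obtain ⟨s, hs, hsn⟩ := h𝒱n x
    have hT : T.card ≤ S.card := by
      rw [hS]
      refine le_trans (Finset.card_le_card_of_injOn (fun i => ((i : 𝒱) : Set X)) ?_ ?_) hsn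
      · intro i hi
        exact hs ⟨i.1.2, hρU i x (Finset.mem_filter.mp hi).2⟩
      · exact fun i _ j _ hij => Subtype.ext (Subtype.ext hij)
    have hli := linearIndepOn_finset_iff.mp (hind T (Finset.subset_univ _) S hT)
      (fun i => ρ i x) (by
        ext k
        have := hzero k k.2
        rw [Finset.sum_apply] at this ⊢
        rw [Finset.sum_subset (Finset.subset_univ T) (fun i _ hi => ?_)]
        · simpa using this
        · have : ρ i x = 0 := by simpa [T] using hi
          simp [this])
    have h0 : ∀ i, ρ i x = 0 := fun i => by
      by_contra h
      exact h (hli i (by simpa [T] using h))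
    simpa [h0] using hsum x

theorem exists_isOpen_pairwiseDisjoint_smul {Γ X : Type*} [Group Γ] [TopologicalSpace X]
    [T2Space X] [MulAction Γ X] [ContinuousConstSMul Γ X] (F : Finset Γ) {K : Set X} (hK : IsCompact K)
    (hF : (F : Set Γ).PairwiseDisjoint fun g => g • K) :
    ∃ O : Set X, IsOpen O ∧ K ⊆ O ∧ (F : Set Γ).PairwiseDisjoint fun g => g • O := by
  classical
  have hpair : ∀ p : Γ × Γ, ∃ O : Set X, IsOpen O ∧ K ⊆ O ∧
      (p.1 ∈ F → p.2 ∈ F → p.1 ≠ p.2 → Disjoint (p.1 • O) (p.2 • O)) := by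
    rintro ⟨g, h⟩
    by_cases hgh : g ∈ F ∧ h ∈ F ∧ g ≠ h
    · obtain ⟨A, B, hA, hB, hgA, hhB, hAB⟩ := SeparatedNhds.of_isCompact_isCompact
        (hK.smul g) (hK.smul h) (hF hgh.1 hgh.2.1 hgh.2.2)
      refine ⟨g⁻¹ • A ∩ h⁻¹ • B, (hA.smul _).inter (hB.smul _), fun x hx => ⟨?_, ?_⟩,
        fun _ _ _ => hAB.mono ?_ ?_⟩
      · exact Set.mem_inv_smul_set_iff.mpr (hgA (Set.smul_mem_smul_set hx))
      · exact Set.mem_inv_smul_set_iff.mpr (hhB (Set.smul_mem_smul_set hx))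
      · rintro _ ⟨x, hx, rfl⟩
        exact Set.mem_inv_smul_set_iff.mp hx.1
      · rintro _ ⟨x, hx, rfl⟩
        exact Set.mem_inv_smul_set_iff.mp hx.2
    · exact ⟨Set.univ, isOpen_univ, Set.subset_univ _, fun h1 h2 h3 => absurd ⟨h1, h2, h3⟩ hgh⟩
  choose O hO hKO hdisj using hpair
  refine ⟨⋂ p ∈ F ×ˢ F, O p, isOpen_biInter_finset fun p _ => hO p,
    Set.subset_iInter₂ fun p _ => hKO p, fun g hg h hh hgh => ?_⟩
  refine (hdisj (g, h) hg hh hgh).mono ?_ ?_ <;>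
  · refine Set.smul_set_mono (Set.iInter₂_subset (g, h) ?_)
    exact Finset.mk_mem_product hg hh

theorem pairwiseDisjoint_smul_singleton {Γ X : Type*} [Group Γ] [MulAction Γ X]
    (hfree : ∀ (g : Γ) (x : X), g • x = x → g = 1)
    (F : Set Γ) (x : X) : F.PairwiseDisjoint fun g => g • ({x} : Set X) := by
  intro g _ h _ hgh
  simp only [Function.onFun, Set.smul_set_singleton, Set.disjoint_singleton]
  intro heq
  have := hfree (h⁻¹ * g) x (by rw [mul_smul, heq, inv_smul_smul])
  exact hgh (inv_mul_eq_one.mp this).symm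

theorem eq_of_inv_smul_mem {Γ X : Type*} [Group Γ] [MulAction Γ X] {F : Set Γ} {U : Set X}
    (hF : F.PairwiseDisjoint fun g => g • U) {g h : Γ} (hg : g ∈ F) (hh : h ∈ F) {x : X}
    (hgx : g⁻¹ • x ∈ U) (hhx : h⁻¹ • x ∈ U) : g = h :=
  hF.elim_set hg hh x (Set.mem_smul_set_iff_inv_smul_mem.mpr hgx)
    (Set.mem_smul_set_iff_inv_smul_mem.mpr hhx)

theorem pairwiseDisjoint_smul_of_forall {Γ X : Type*} [Group Γ] [MulAction Γ X] {F : Set Γ}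
    {U : Set X} (h : ∀ f ∈ F, ∀ g ∈ F, ∀ x, f⁻¹ • x ∈ U → g⁻¹ • x ∈ U → f = g) :
    F.PairwiseDisjoint fun g => g • U := fun f hf g hg hfg =>
  Set.disjoint_left.mpr fun x hfx hgx => hfg (h f hf g hg x
    (Set.mem_smul_set_iff_inv_smul_mem.mp hfx) (Set.mem_smul_set_iff_inv_smul_mem.mp hgx))

theorem exists_seq_mul_ne_mul (Γ : Type*) [Group Γ] [Infinite Γ] (A : Finset Γ) :
    ∃ g : ℕ → Γ, ∀ i j, ∀ a ∈ A, ∀ b ∈ A, g i * a = g j * b → i = j := by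
  classical
  have : Std.Symm fun x y : Γ => ∀ a ∈ A, ∀ b ∈ A, x * a ≠ y * b :=
    ⟨fun x y h a ha b hb e => h b hb a ha e.symm⟩
  obtain ⟨g, -, hg⟩ := exists_seq_of_forall_finset_exists' (fun _ : Γ => True)
    (fun x y => ∀ a ∈ A, ∀ b ∈ A, x * a ≠ y * b) fun s _ => by
      obtain ⟨y, hy⟩ := Infinite.exists_notMem_finset (s * A * A⁻¹)
      refine ⟨y, trivial, fun x hx a ha b hb e => hy ?_⟩
      rw [eq_mul_inv_of_mul_eq e.symm]
      exact Finset.mul_mem_mul (Finset.mul_mem_mul hx ha) (Finset.inv_mem_inv hb)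
  refine ⟨g, fun i j a ha b hb e => ?_⟩
  by_contra hij
  exact hg hij a ha b hb e

section Markers

variable {Γ X : Type*} [Group Γ] [TopologicalSpace X] [CompactSpace X] [T2Space X]
  [MulAction Γ X] [ContinuousConstSMul Γ X]

theorem exists_near_few_zeros_on {n : ℕ} (hX : CovDimLE X n) (D : Finset Γ) {Y Z O : Set X}
    (hY : IsClosed Y) (hZ : IsClosed Z) (hO : IsOpen O) (hZO : Z ⊆ O)
    (hdisj : (D : Set Γ).PairwiseDisjoint fun g => g • O) {u : X → ℝ} (hu : Continuous u)
    (huY : ∀ y ∈ Y, ∀ S ⊆ D, S.card = n + 1 → ∃ g ∈ S, u (g • y) ≠ 0)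
    {ε : ℝ} (hε : 0 < ε) :
    ∃ w : X → ℝ, Continuous w ∧ (∀ x, |w x - u x| ≤ ε) ∧
      ∀ y ∈ Y ∪ Z, ∀ S ⊆ D, S.card = n + 1 → ∃ g ∈ S, w (g • y) ≠ 0 := by
  classical
  obtain ⟨δ, hδ, hδε, hδY⟩ : ∃ δ > 0, δ ≤ ε ∧
      ∀ y ∈ Y, ∀ S ⊆ D, S.card = n + 1 → ∃ g ∈ S, δ < |u (g • y)| := by
    have hone : ∀ S : Finset Γ, ∃ δ > 0, S ⊆ D → S.card = n + 1 →
        ∀ y ∈ Y, ∃ g ∈ S, δ < |u (g • y)| := by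
      intro S
      by_cases hS : S ⊆ D ∧ S.card = n + 1
      · rcases Y.eq_empty_or_nonempty with rfl | hYne
        · exact ⟨1, one_pos, by simp⟩
        · have hcont : Continuous fun y => ∑ g ∈ S, |u (g • y)| := by fun_prop
          obtain ⟨y₀, hy₀, hmin⟩ := hY.isCompact.exists_isMinOn hYne hcont.continuousOn
          have hpos : 0 < ∑ g ∈ S, |u (g • y₀)| := by
            obtain ⟨g, hg, hne⟩ := huY y₀ hy₀ S hS.1 hS.2
            exact Finset.sum_pos' (fun _ _ => abs_nonneg _) ⟨g, hg, abs_pos.mpr hne⟩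
          refine ⟨(∑ g ∈ S, |u (g • y₀)|) / (n + 2), by positivity, fun _ _ y hy => ?_⟩
          by_contra! hle
          have h1 := Finset.sum_le_card_nsmul S _ _ hle
          have h2 := isMinOn_iff.mp hmin y hy
          have h3 := h2.trans h1
          rw [hS.2, nsmul_eq_mul, mul_div_assoc', le_div_iff₀ (by positivity)] at h3
          push_cast at h3
          nlinarith
      · exact ⟨1, one_pos, fun h1 h2 => absurd ⟨h1, h2⟩ hS⟩
    choose d hd hdY using hone
    obtain ⟨S₀, -, hS₀⟩ := D.powerset.exists_min_image d ⟨∅, by simp⟩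
    refine ⟨min ε (d S₀), lt_min hε (hd _), min_le_left _ _, fun y hy S hS hSn => ?_⟩
    obtain ⟨g, hg, hlt⟩ := hdY S hS hSn y hy
    exact ⟨g, hg, ((min_le_right _ _).trans (hS₀ S (Finset.mem_powerset.mpr hS))).trans_lt hlt⟩
  obtain ⟨v, hv, hvu, hv0⟩ := hX.exists_near_few_zeros
    (v := fun x (g : D) => u ((g : Γ) • x)) (by fun_prop) hδ
  obtain ⟨χ, hχ0, hχ1, hχ⟩ := exists_continuous_zero_one_of_isClosed hO.isClosed_compl hZ
    (Set.disjoint_left.mpr fun x hx hxZ => hx (hZO hxZ))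
  let p : D → X → ℝ := fun g y => χ ((g : Γ)⁻¹ • y) * (v ((g : Γ)⁻¹ • y) g - u y)
  have hp0 : ∀ (g : D) y, (g : Γ)⁻¹ • y ∉ O → p g y = 0 := fun g y hy => by
    have : χ ((g : Γ)⁻¹ • y) = 0 := hχ0 hy
    simp [p, this]
  have hpδ : ∀ g y, |p g y| ≤ δ := fun g y => by
    have h1 := (dist_le_pi_dist (v ((g : Γ)⁻¹ • y)) _ g).trans (hvu ((g : Γ)⁻¹ • y))
    rw [Real.dist_eq, smul_inv_smul] at h1
    rw [abs_mul, abs_of_nonneg (hχ _).1]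
    exact (mul_le_of_le_one_left (abs_nonneg _) (hχ _).2).trans h1
  have hpsum : ∀ (g : D) y, (g : Γ)⁻¹ • y ∈ O → ∑ h, p h y = p g y := fun g y hy => by
    refine Finset.sum_eq_single g (fun h _ hne => hp0 h y fun hh => ?_) (by simp)
    exact Set.disjoint_left.mp (hdisj h.2 g.2 fun e => hne (Subtype.ext e))
      (Set.mem_smul_set_iff_inv_smul_mem.mpr hh) (Set.mem_smul_set_iff_inv_smul_mem.mpr hy)
  have hsumδ : ∀ y, |∑ h, p h y| ≤ δ := fun y => by
    by_cases hy : ∃ g : D, (g : Γ)⁻¹ • y ∈ O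
    · obtain ⟨g, hg⟩ := hy
      rw [hpsum g y hg]
      exact hpδ g y
    · push Not at hy
      rw [Finset.sum_eq_zero fun g _ => hp0 g y (hy g), abs_zero]
      exact hδ.le
  refine ⟨fun y => u y + ∑ h, p h y, ?_, fun x => ?_, ?_⟩
  · have : ∀ h, Continuous (p h) := fun h => by
      have hvh : Continuous fun x => v x h := (continuous_apply h).comp hv
      have h1 : Continuous fun y : X => (h : Γ)⁻¹ • y := continuous_const_smul _
      exact (χ.continuous.comp h1).mul ((hvh.comp h1).sub hu)
    fun_prop
  · rw [add_sub_cancel_left]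
    exact (hsumδ x).trans hδε
  · rintro y (hy | hy) S hS hSn
    · obtain ⟨g, hg, hlt⟩ := hδY y hy S hS hSn
      refine ⟨g, hg, fun h0 => ?_⟩
      have := hsumδ (g • y)
      rw [eq_neg_of_add_eq_zero_left h0, abs_neg] at hlt
      exact absurd this (not_le.mpr hlt)
    · obtain ⟨g, hg, hne⟩ := hv0 y (S.subtype (· ∈ D)) (by
        rw [Finset.card_subtype, Finset.filter_true_of_mem fun g hg => hS hg, hSn])
      refine ⟨g, Finset.mem_subtype.mp hg, ?_⟩
      have hχy : χ y = 1 := hχ1 hy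
      change u _ + ∑ h, p h _ ≠ 0
      rw [hpsum g _ (by rw [inv_smul_smul]; exact hZO hy)]
      simpa [p, hχy] using hne

theorem CovDimLE.exists_near_few_orbit_zeros {n : ℕ} (hX : CovDimLE X n)
    (hfree : ∀ (g : Γ) (x : X), g • x = x → g = 1) (D : Finset Γ) {u : X → ℝ}
    (hu : Continuous u) {ε : ℝ} (hε : 0 < ε) :
    ∃ w : X → ℝ, Continuous w ∧ (∀ x, |w x - u x| ≤ ε) ∧
      ∀ x, ∀ S ⊆ D, S.card = n + 1 → ∃ g ∈ S, w (g • x) ≠ 0 := by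
  have main : ∀ Y : Set X, IsCompact Y → ∃ Y', IsClosed Y' ∧ Y ⊆ Y' ∧ ∀ u : X → ℝ,
      Continuous u → ∀ A : Set X, IsClosed A →
      (∀ y ∈ A, ∀ S ⊆ D, S.card = n + 1 → ∃ g ∈ S, u (g • y) ≠ 0) → ∀ ε > 0,
      ∃ w : X → ℝ, Continuous w ∧ (∀ x, |w x - u x| ≤ ε) ∧
        ∀ y ∈ A ∪ Y', ∀ S ⊆ D, S.card = n + 1 → ∃ g ∈ S, w (g • y) ≠ 0 := by
    intro Y hY
    refine hY.induction_on ?_ ?_ ?_ ?_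
    · exact ⟨∅, isClosed_empty, le_rfl, fun u hu A _ hA ε hε =>
        ⟨u, hu, fun x => by simpa using hε.le, by simpa using hA⟩⟩
    · rintro s t hst ⟨Y', h1, h2, h3⟩
      exact ⟨Y', h1, hst.trans h2, h3⟩
    · rintro s t ⟨Y₁, hc₁, hs₁, h₁⟩ ⟨Y₂, hc₂, hs₂, h₂⟩
      refine ⟨Y₁ ∪ Y₂, hc₁.union hc₂, Set.union_subset_union hs₁ hs₂,
        fun u hu A hA huA ε hε => ?_⟩
      obtain ⟨w₁, hw₁, hd₁, hz₁⟩ := h₁ u hu A hA huA (ε / 2) (half_pos hε)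
      obtain ⟨w₂, hw₂, hd₂, hz₂⟩ := h₂ w₁ hw₁ _ (hA.union hc₁) hz₁ (ε / 2) (half_pos hε)
      refine ⟨w₂, hw₂, fun x => ?_, by rwa [← Set.union_assoc]⟩
      linarith [abs_sub_le (w₂ x) (w₁ x) (u x), hd₁ x, hd₂ x]
    · intro x _
      obtain ⟨O, hO, hxO, hdisj⟩ := exists_isOpen_pairwiseDisjoint_smul D
        (isCompact_singleton (x := x)) (pairwiseDisjoint_smul_singleton hfree _ x)
      obtain ⟨Z, hZx, hZ, hZO⟩ := exists_mem_nhds_isClosed_subset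
        (hO.mem_nhds (hxO rfl))
      exact ⟨Z, mem_nhdsWithin_of_mem_nhds hZx, Z, hZ, le_rfl, fun u hu A hA huA ε hε =>
        exists_near_few_zeros_on hX D hA hZ hO hZO hdisj hu huA hε⟩
  obtain ⟨Y', -, hY', h⟩ := main Set.univ isCompact_univ
  obtain ⟨w, hw, hd, hz⟩ := h u hu ∅ isClosed_empty (by simp) ε hε
  exact ⟨w, hw, hd, fun x => hz x (Or.inr (hY' trivial))⟩

theorem CovDimLE.exists_extend_marker {n : ℕ} (hX : CovDimLE X n) [Infinite Γ]
    (hfree : ∀ (g : Γ) (x : X), g • x = x → g = 1) (F : Finset Γ) :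
    ∃ S : Finset Γ, ∀ V C K : Set X, IsOpen V →
      (S : Set Γ).PairwiseDisjoint (fun g => g • V) → IsClosed C → C ⊆ V → IsClosed K →
      (F : Set Γ).PairwiseDisjoint (fun g => g • K) →
      ∃ K' : Set X, IsClosed K' ∧ (F : Set Γ).PairwiseDisjoint (fun g => g • K') ∧
        (⋃ g : Γ, g • interior K) ∪ C ⊆ ⋃ g : Γ, g • interior K' := by
  classical
  obtain ⟨g, hg⟩ := exists_seq_mul_ne_mul Γ (F⁻¹ * F)
  refine ⟨F * ((Finset.range (n + 1)).image g)⁻¹, fun V C K hV hVS hC hCV hK hKF => ?_⟩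
  obtain ⟨O, hO, hKO, hOF⟩ := exists_isOpen_pairwiseDisjoint_smul F hK.isCompact hKF
  obtain ⟨f, hf0, hf1, -⟩ := exists_continuous_zero_one_of_isClosed hO.isClosed_compl hK
    (Set.disjoint_left.mpr fun x hx hxK => hx (hKO hxK))
  obtain ⟨w, hw, hwf, hw0⟩ := hX.exists_near_few_orbit_zeros hfree
    (((Finset.range (n + 1)).image g * (F⁻¹ * F))⁻¹) (u := fun x => 2 * f x - 1)
    (by fun_prop) (ε := 1 / 2) (by norm_num)
  have hKw : ∀ x ∈ K, 0 < w x := fun x hx => by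
    have h1 : f x = 1 := hf1 hx
    have h2 := abs_le.mp (hwf x)
    rw [h1] at h2
    linarith [h2.1]
  have hwO : ∀ x, 0 ≤ w x → x ∈ O := fun x hx => by
    by_contra hxO
    have h1 : f x = 0 := hf0 hxO
    have h2 := abs_le.mp (hwf x)
    rw [h1] at h2
    linarith [h2.2]
  let L : Set X := {x | 0 ≤ w x}
  let U : Set X := {x | 0 < w x}
  have hL : IsClosed L := isClosed_le continuous_const hw
  have hU : IsOpen U := isOpen_lt continuous_const hw
  let P : Option (Fin (n + 1)) → Set X := fun o => o.elim (⋃ h : Γ, h • U)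
    fun i => V \ ⋃ a ∈ F⁻¹ * F, (g i * a) • L
  have hPo : ∀ o, IsOpen (P o) := by
    rintro (_ | i)
    · exact isOpen_iUnion fun h => hU.smul h
    · refine hV.sdiff (Set.Finite.isClosed_biUnion (Finset.finite_toSet _) fun a _ => hL.smul _)
  have hPC : C ⊆ ⋃ o, P o := by
    intro x hx
    by_contra hxP
    rw [Set.mem_iUnion] at hxP
    push Not at hxP
    have hxU : ∀ h : Γ, ¬ 0 < w (h⁻¹ • x) := fun h hh => hxP none
      (Set.mem_iUnion.mpr ⟨h, Set.mem_smul_set_iff_inv_smul_mem.mpr hh⟩)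
    have hxi : ∀ i : Fin (n + 1), ∃ a ∈ F⁻¹ * F, w ((g i * a)⁻¹ • x) = 0 := fun i => by
      by_contra! hne
      refine hxP (some i) ⟨hCV hx, fun hmem => ?_⟩
      obtain ⟨a, ha, hxa⟩ := Set.mem_iUnion₂.mp hmem
      exact hxU _ (lt_of_le_of_ne (Set.mem_smul_set_iff_inv_smul_mem.mp hxa) (hne a ha).symm)
    choose a ha hwa using hxi
    obtain ⟨k, hk, hne⟩ := hw0 x (Finset.univ.image fun i : Fin (n + 1) => (g i * a i)⁻¹) (by
        intro k hk
        obtain ⟨i, -, rfl⟩ := Finset.mem_image.mp hk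
        exact Finset.inv_mem_inv (Finset.mul_mem_mul
          (Finset.mem_image_of_mem _ (Finset.mem_range.mpr i.2)) (ha i))) (by
        rw [Finset.card_image_of_injective, Finset.card_univ, Fintype.card_fin]
        exact fun i j hij => Fin.ext (hg i j _ (ha i) _ (ha j) (inv_injective hij)))
    obtain ⟨i, -, rfl⟩ := Finset.mem_image.mp hk
    exact hne (hwa i)
  obtain ⟨v, hCv, hvo, hvP⟩ := exists_subset_iUnion_closure_subset hC hPo
    (fun x _ => Set.toFinite _) hPC
  let Q : Fin (n + 1) → Set X := fun i => closure (v (some i))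
  have hQV : ∀ i, Q i ⊆ V := fun i x hx => (hvP (some i) hx).1
  have hLQ : ∀ e ∈ F, ∀ e' ∈ F, ∀ x, e⁻¹ • x ∈ L → ∀ i, g i • e'⁻¹ • x ∉ Q i := by
    intro e he e' he' x hx i hxi
    refine (hvP (some i) hxi).2 (Set.mem_iUnion₂.mpr ⟨e'⁻¹ * e,
      Finset.mul_mem_mul (Finset.inv_mem_inv he') he, ?_⟩)
    rw [Set.mem_smul_set_iff_inv_smul_mem]
    simpa [mul_smul] using hx
  have hQQ : ∀ e ∈ F, ∀ e' ∈ F, ∀ x i j, g i • e⁻¹ • x ∈ Q i → g j • e'⁻¹ • x ∈ Q j →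
      e = e' := by
    intro e he e' he' x i j hi hj
    have hmem : ∀ e ∈ F, ∀ i : Fin (n + 1), e * (g i)⁻¹ ∈
        ((F * ((Finset.range (n + 1)).image g)⁻¹ : Finset Γ) : Set Γ) := fun e he i =>
      Finset.mul_mem_mul he (Finset.inv_mem_inv
        (Finset.mem_image_of_mem _ (Finset.mem_range.mpr i.2)))
    have heq := eq_of_inv_smul_mem hVS (hmem e he i) (hmem e' he' j) (x := x)
      (by simpa [mul_smul] using hQV i hi) (by simpa [mul_smul] using hQV j hj)
    have hij : (i : ℕ) = j := by
      refine hg i j (e⁻¹ * e) (Finset.mul_mem_mul (Finset.inv_mem_inv he) he)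
        (e'⁻¹ * e) (Finset.mul_mem_mul (Finset.inv_mem_inv he') he) ?_
      have hgj : g j = g i * (e⁻¹ * e') := by
        rw [← inv_inj, eq_inv_mul_of_mul_eq heq.symm]
        group
      rw [hgj]
      group
    rw [hij] at heq
    exact mul_right_cancel heq
  refine ⟨L ∪ ⋃ i : Fin (n + 1), (g i)⁻¹ • Q i,
    hL.union (isClosed_iUnion_of_finite fun i => isClosed_closure.smul _), ?_, ?_⟩
  · refine pairwiseDisjoint_smul_of_forall fun e he e' he' x hx hx' => ?_
    simp only [Set.mem_union, Set.mem_iUnion, Set.mem_inv_smul_set_iff] at hx hx'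
    rcases hx with hx | ⟨i, hx⟩ <;> rcases hx' with hx' | ⟨j, hx'⟩
    · exact eq_of_inv_smul_mem hOF he he' (hwO _ hx) (hwO _ hx')
    · exact absurd hx' (hLQ e he e' he' x hx j)
    · exact absurd hx (hLQ e' he' e he x hx' i)
    · exact hQQ e he e' he' x i j hx hx'
  · have hUint : U ⊆ interior (L ∪ ⋃ i : Fin (n + 1), (g i)⁻¹ • Q i) :=
      interior_maximal (fun x (hx : 0 < w x) => Or.inl hx.le) hU
    refine Set.union_subset (Set.iUnion_mono fun h => Set.smul_set_mono
      fun x hx => hUint (hKw x (interior_subset hx))) fun x hx => ?_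
    obtain ⟨_ | i, hxo⟩ := Set.mem_iUnion.mp (hCv hx)
    · exact Set.iUnion_mono (fun h => Set.smul_set_mono hUint) (hvP none (subset_closure hxo))
    · refine Set.mem_iUnion.mpr ⟨g i, Set.mem_smul_set_iff_inv_smul_mem.mpr ?_⟩
      refine interior_maximal (t := (g i)⁻¹ • v (some i)) ?_ ((hvo _).smul _)
        (Set.smul_mem_smul_set hxo)
      exact fun y hy => Or.inr (Set.mem_iUnion.mpr ⟨i, Set.smul_set_mono subset_closure hy⟩)

theorem CovDimLE.exists_marker {n : ℕ} (hX : CovDimLE X n) [Infinite Γ]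
    (hfree : ∀ (g : Γ) (x : X), g • x = x → g = 1) (F : Finset Γ) :
    ∃ K O : Set X, IsClosed K ∧ IsOpen O ∧ K ⊆ O ∧
      (F : Set Γ).PairwiseDisjoint (fun g => g • O) ∧ ⋃ g : Γ, g • interior K = Set.univ := by
  obtain ⟨S, hS⟩ := hX.exists_extend_marker hfree F
  have main : ∀ Y : Set X, IsCompact Y → ∀ K : Set X, IsClosed K →
      (F : Set Γ).PairwiseDisjoint (fun g => g • K) →
      ∃ K' : Set X, IsClosed K' ∧ (F : Set Γ).PairwiseDisjoint (fun g => g • K') ∧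
        (⋃ g : Γ, g • interior K) ∪ Y ⊆ ⋃ g : Γ, g • interior K' := by
    intro Y hY
    refine hY.induction_on ?_ ?_ ?_ ?_
    · exact fun K hK hKF => ⟨K, hK, hKF, by simp⟩
    · intro s t hst h K hK hKF
      obtain ⟨K', h1, h2, h3⟩ := h K hK hKF
      exact ⟨K', h1, h2, (Set.union_subset_union_right _ hst).trans h3⟩
    · intro s t hs ht K hK hKF
      obtain ⟨K₁, h1, h2, h3⟩ := hs K hK hKF
      obtain ⟨K₂, h4, h5, h6⟩ := ht K₁ h1 h2
      refine ⟨K₂, h4, h5, ?_⟩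
      rw [← Set.union_assoc]
      exact (Set.union_subset_union_left _ h3).trans h6
    · intro x _
      obtain ⟨O, hO, hxO, hdisj⟩ := exists_isOpen_pairwiseDisjoint_smul S
        (isCompact_singleton (x := x)) (pairwiseDisjoint_smul_singleton hfree _ x)
      obtain ⟨Z, hZx, hZ, hZO⟩ := exists_mem_nhds_isClosed_subset (hO.mem_nhds (hxO rfl))
      exact ⟨Z, mem_nhdsWithin_of_mem_nhds hZx,
        fun K hK hKF => hS O Z K hO hdisj hZ hZO hK hKF⟩
  obtain ⟨K, hK, hKF, hcov⟩ := main Set.univ isCompact_univ ∅ isClosed_empty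
    (by intro _ _ _ _ _; simp [Function.onFun])
  obtain ⟨O, hO, hKO, hOF⟩ := exists_isOpen_pairwiseDisjoint_smul F hK.isCompact hKF
  exact ⟨K, O, hK, hO, hKO, hOF,
    Set.eq_univ_of_univ_subset (Set.subset_union_right.trans hcov)⟩

end Markers

theorem dynF_subset_of_invariant {Γ X : Type*} [Group Γ] [MulAction Γ X] {U : Set X}
    {E R : Set Γ} (h : ∀ x ∈ U, ∃ Q ⊆ R, (1 : Γ) ∈ Q ∧
      ∀ p ∈ Q, ∀ e ∈ E, p • x ∈ U → (e * p) • x ∈ U → e * p ∈ Q) : dynF U E ⊆ R := by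
  rintro _ ⟨L, -, hLE, rfl, x, hx, hL⟩
  obtain ⟨Q, hQR, hQ1, hQ⟩ := h x hx
  have hmem : ∀ j ≤ L.length, (L.take j).reverse.prod ∈ Q ∧ (L.take j).reverse.prod • x ∈ U := by
    intro j
    induction j with
    | zero => exact fun _ => by simpa using ⟨hQ1, hx⟩
    | succ j ih =>
      intro hj
      obtain ⟨h1, h2⟩ := ih (Nat.le_of_succ_le hj)
      have h3 := hL (j + 1) (Nat.le_add_left 1 j) hj
      have heq : (L.take (j + 1)).reverse.prod = L[j] * (L.take j).reverse.prod := by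
        rw [List.take_succ_eq_append_getElem hj, List.reverse_append, List.prod_append,
          List.reverse_singleton, List.prod_singleton]
      rw [heq] at h3 ⊢
      exact ⟨hQ _ h1 _ (hLE _ (List.getElem_mem hj)) h2 h3, h3⟩
  simpa using hQR (hmem L.length le_rfl).1

/-- A coarse equivalence onto `ℤ`, for the coarse structure given by right translation. -/
structure IsHeight {Γ : Type*} [Group Γ] (φ : Γ → ℤ) : Prop where
  surjective : Function.Surjective φ
  exists_abs_sub_le : ∀ E : Finset Γ, ∃ M : ℕ, ∀ e ∈ E, ∀ g, |φ (e * g) - φ g| ≤ M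
  finite_setOf_div : ∀ N : ℕ, {a : Γ | ∃ g h, a = g * h⁻¹ ∧ |φ g - φ h| ≤ N}.Finite

theorem IsVirtuallyCyclic.exists_zpow_injective {Γ : Type*} [Group Γ] [Infinite Γ]
    (hΓ : IsVirtuallyCyclic Γ) :
    ∃ t : Γ, (Subgroup.zpowers t).FiniteIndex ∧ Function.Injective fun k : ℤ => t ^ k := by
  obtain ⟨H, hH, hfin⟩ := hΓ
  obtain ⟨t, rfl⟩ := (Subgroup.isCyclic_iff_exists_zpowers_eq_top H).mp hH
  refine ⟨t, hfin, ?_⟩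
  rw [injective_zpow_iff_not_isOfFinOrder]
  intro ht
  have : Finite (Subgroup.zpowers t) := ht.finite_zpowers
  have : Finite (Γ ⧸ Subgroup.zpowers t) := Subgroup.finite_quotient_of_finiteIndex
  have : Finite Γ := Finite.of_equiv _ (Subgroup.groupEquivQuotientProdSubgroup
    (s := Subgroup.zpowers t)).symm
  exact not_finite Γ

theorem IsVirtuallyCyclic.exists_isHeight {Γ : Type*} [Group Γ] [Infinite Γ]
    (hΓ : IsVirtuallyCyclic Γ) : ∃ φ : Γ → ℤ, IsHeight φ := by
  classical
  obtain ⟨t, hfin, ht⟩ := hΓ.exists_zpow_injective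
  let r : Γ → Γ := fun g => (QuotientGroup.mk g : Γ ⧸ Subgroup.zpowers t).out
  have hr : (Set.range r).Finite := by
    have : Finite (Γ ⧸ Subgroup.zpowers t) := Subgroup.finite_quotient_of_finiteIndex
    exact (Set.finite_range (Quotient.out : Γ ⧸ Subgroup.zpowers t → Γ)).subset
      (Set.range_subset_iff.mpr fun g => ⟨_, rfl⟩)
  have hrt : ∀ g (k : ℤ), r (g * t ^ k) = r g := fun g k => by
    have : (QuotientGroup.mk (g * t ^ k) : Γ ⧸ Subgroup.zpowers t) = QuotientGroup.mk g :=
      QuotientGroup.mk_mul_of_mem g (Subgroup.zpow_mem_zpowers t k)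
    simp only [r, this]
  have hφ : ∀ g, ∃ k : ℤ, t ^ k = (r g)⁻¹ * g := fun g =>
    Subgroup.mem_zpowers_iff.mp (QuotientGroup.eq.mp (QuotientGroup.out_eq' _))
  choose φ hφ using hφ
  have hsub : ∀ g h, t ^ (φ g - φ h) = (r g)⁻¹ * (g * h⁻¹) * r h := fun g h => by
    rw [zpow_sub, hφ, hφ]
    group
  refine ⟨φ, fun n => ⟨t ^ (n - φ 1), ?_⟩, fun E => ?_, fun N => ?_⟩
  · have h1 := hφ (1 * t ^ (n - φ 1))
    rw [hrt, ← mul_assoc, ← hφ 1, ← zpow_add, one_mul] at h1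
    have := ht h1
    omega
  · have hfinset : {k : ℤ | t ^ k ∈ (Set.range r)⁻¹ * (E : Set Γ) * Set.range r}.Finite :=
      ((hr.inv.mul E.finite_toSet).mul hr).preimage ht.injOn
    obtain ⟨M, hM⟩ := (hfinset.image Int.natAbs).bddAbove
    refine ⟨M, fun e he g => ?_⟩
    have : (φ (e * g) - φ g).natAbs ≤ M := hM ⟨_, ?_, rfl⟩
    · rw [Int.abs_eq_natAbs]
      exact_mod_cast this
    · rw [Set.mem_ofPred_eq, hsub, mul_inv_cancel_right]
      exact Set.mul_mem_mul (Set.mul_mem_mul (Set.inv_mem_inv.mpr ⟨_, rfl⟩) he) ⟨_, rfl⟩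
  · refine ((hr.mul ((Set.finite_Icc (-(N : ℤ)) N).image fun k => t ^ k)).mul hr.inv).subset ?_
    rintro _ ⟨g, h, rfl, hgh⟩
    have heq : g * h⁻¹ = r g * t ^ (φ g - φ h) * (r h)⁻¹ := by
      rw [hsub]
      group
    rw [heq]
    exact Set.mul_mem_mul (Set.mul_mem_mul ⟨_, rfl⟩ ⟨_, abs_le.mp hgh, rfl⟩)
      (Set.inv_mem_inv.mpr ⟨_, rfl⟩)

theorem finite_dynF_smul {Γ X : Type*} [Group Γ] [MulAction Γ X] [DecidableEq Γ]
    {E B : Finset Γ} {O : Set X}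
    (hO : ((B ∪ E * B : Finset Γ) : Set Γ).PairwiseDisjoint fun g => g • O) :
    (dynF (⋃ b ∈ B, b • O) (E : Set Γ)).Finite := by
  refine (B * B⁻¹).finite_toSet.subset (dynF_subset_of_invariant fun x hx => ?_)
  obtain ⟨b, hb, hxb⟩ := Set.mem_iUnion₂.mp hx
  refine ⟨{p | p * b ∈ B}, fun p hp => ?_, by simpa using hb, fun p hp e he _ hepx => ?_⟩
  · rw [← mul_inv_cancel_right p b]
    exact Finset.mul_mem_mul hp (Finset.inv_mem_inv hb)
  · obtain ⟨b', hb', hxb'⟩ := Set.mem_iUnion₂.mp hepx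
    rw [Set.mem_smul_set_iff_inv_smul_mem] at hxb hxb'
    have : e * (p * b) = b' := eq_of_inv_smul_mem hO
      (Finset.mem_union_right _ (Finset.mul_mem_mul he hp)) (Finset.mem_union_left _ hb')
      (x := (e * p) • x) (by simpa [mul_smul] using hxb) hxb'
    rw [Set.mem_ofPred_eq, mul_assoc, this]
    exact hb'

theorem IsHeight.finite_dynF_compl {Γ X : Type*} [Group Γ] [MulAction Γ X] {φ : Γ → ℤ}
    (hφ : IsHeight φ) {E B L : Finset Γ} {M : ℕ} (hM : ∀ e ∈ E, ∀ g, |φ (e * g) - φ g| ≤ M)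
    (hB : ∀ g h, |φ g - φ h| ≤ M → g * h⁻¹ ∈ B) {K : Set X}
    (hL : ⋃ l ∈ L, l • K = Set.univ) :
    (dynF (⋃ b ∈ B, b • K)ᶜ (E : Set Γ)).Finite := by
  classical
  obtain ⟨N, hN⟩ := hφ.exists_abs_sub_le L⁻¹
  have hvisit : ∀ (x : X) (m : ℤ), ∃ s : Γ, s • x ∈ K ∧ |φ s - m| ≤ N := fun x m => by
    obtain ⟨g, rfl⟩ := hφ.surjective m
    obtain ⟨l, hl, hgx⟩ := Set.mem_iUnion₂.mp (hL.ge (Set.mem_univ (g • x)))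
    rw [Set.mem_smul_set_iff_inv_smul_mem, ← mul_smul] at hgx
    exact ⟨_, hgx, hN _ (Finset.inv_mem_inv hl) g⟩
  have hbarrier : ∀ (x : X) (s p : Γ), s • x ∈ K → p • x ∈ (⋃ b ∈ B, b • K)ᶜ →
      (M : ℤ) < |φ p - φ s| := fun x s p hs hp => by
    by_contra! hle
    refine hp (Set.mem_iUnion₂.mpr ⟨_, hB _ _ hle, ?_⟩)
    rw [Set.mem_smul_set_iff_inv_smul_mem]
    simpa [mul_smul] using hs
  refine (hφ.finite_setOf_div (M + 2 * N + 1)).subset (dynF_subset_of_invariant fun x hx => ?_)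
  obtain ⟨s, hs, hsφ⟩ := hvisit x (φ 1 + (M + N + 1))
  obtain ⟨s', hs', hsφ'⟩ := hvisit x (φ 1 - (M + N + 1))
  rw [abs_le] at hsφ hsφ'
  refine ⟨{p | φ s' + M < φ p ∧ φ p < φ s - M}, ?_, ?_, ?_⟩
  · rintro p ⟨h1, h2⟩
    refine ⟨p, 1, by simp, ?_⟩
    rw [abs_le]
    push_cast
    constructor <;> omega
  · constructor <;> omega
  · rintro p ⟨h1, h2⟩ e he - hep
    have h3 := abs_le.mp (hM e he p)
    have h4 := hbarrier x s _ hs hep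
    have h5 := hbarrier x s' _ hs' hep
    rw [lt_abs] at h4 h5
    constructor <;> omega

theorem dadLE_one_of_isHeight {Γ X : Type*} [Group Γ] [Infinite Γ] [TopologicalSpace X]
    [CompactSpace X] [T2Space X] [MulAction Γ X] [ContinuousConstSMul Γ X] {φ : Γ → ℤ}
    (hφ : IsHeight φ) (hfree : ∀ (g : Γ) (x : X), g • x = x → g = 1) {n : ℕ}
    (hX : CovDimLE X n) : DadLE Γ X 1 := by
  classical
  intro E
  obtain ⟨M, hM⟩ := hφ.exists_abs_sub_le E
  let B := (hφ.finite_setOf_div M).toFinset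
  obtain ⟨K, O, hK, hO, hKO, hOF, hcov⟩ := hX.exists_marker hfree (B ∪ E * B)
  obtain ⟨L, hL⟩ := isCompact_univ.elim_finite_subcover (fun g : Γ => g • interior K)
    (fun g => isOpen_interior.smul g) hcov.ge
  refine ⟨![⋃ b ∈ B, b • O, (⋃ b ∈ B, b • K)ᶜ], ?_, ?_, ?_⟩
  · rw [Fin.forall_fin_two]
    exact ⟨isOpen_biUnion fun b _ => hO.smul b,
      (Set.Finite.isClosed_biUnion B.finite_toSet fun b _ => hK.smul b).isOpen_compl⟩
  · refine Set.eq_univ_of_forall fun x => Set.mem_iUnion.mpr ?_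
    by_cases hx : x ∈ ⋃ b ∈ B, b • K
    · exact ⟨0, Set.iUnion₂_mono (fun b _ => Set.smul_set_mono hKO) hx⟩
    · exact ⟨1, hx⟩
  · rw [Fin.forall_fin_two]
    refine ⟨finite_dynF_smul hOF, hφ.finite_dynF_compl hM (L := L) (fun g h hgh => ?_) ?_⟩
    · exact (hφ.finite_setOf_div M).mem_toFinset.mpr ⟨g, h, rfl, hgh⟩
    · exact Set.eq_univ_of_univ_subset
        (hL.trans (Set.iUnion₂_mono fun l _ => Set.smul_set_mono interior_subset))

theorem not_dadLE_zero_of_zpow_injective {Γ X : Type*} [Group Γ] [TopologicalSpace X]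
    [Nonempty X] [MulAction Γ X] {t : Γ} (ht : Function.Injective fun k : ℤ => t ^ k) :
    ¬ DadLE Γ X 0 := by
  intro h
  obtain ⟨U, -, hU, hfin⟩ := h {t}
  have hU0 : U 0 = Set.univ := by
    rw [← hU]
    exact Set.Subset.antisymm (Set.subset_iUnion U 0)
      (Set.iUnion_subset fun i => by rw [Fin.fin_one_eq_zero i])
  have hinj : Function.Injective fun k : ℕ => t ^ (k + 1) := fun j k hjk => by
    have := ht (a₁ := ((j + 1 : ℕ) : ℤ)) (a₂ := ((k + 1 : ℕ) : ℤ)) (by simpa only [zpow_natCast])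
    omega
  refine Set.infinite_range_of_injective hinj ((hfin 0).subset ?_)
  rintro _ ⟨k, rfl⟩
  refine ⟨List.replicate (k + 1) t, by simp, fun a ha => ?_, by simp, Classical.arbitrary X, ?_⟩
  · simpa using List.eq_of_mem_replicate ha
  · simp [hU0]

/-- For a free action of an infinite virtually cyclic group on a nonempty
compact Hausdorff space of finite covering dimension, the dynamic asymptotic dimension
equals 1. -/
theorem dad_eq_one_of_free_finiteDimensional
    (Γ X : Type*) [Group Γ] [Infinite Γ]
    [TopologicalSpace X] [CompactSpace X] [T2Space X] [Nonempty X]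
    [MulAction Γ X] [ContinuousConstSMul Γ X]
    (hvc : IsVirtuallyCyclic Γ)
    (hfree : ∀ (g : Γ) (x : X), g • x = x → g = 1)
    (hdim : ∃ n : ℕ, CovDimLE X n) :
    dad Γ X = 1 := by
  obtain ⟨n, hn⟩ := hdim
  obtain ⟨φ, hφ⟩ := hvc.exists_isHeight
  obtain ⟨t, -, ht⟩ := hvc.exists_zpow_injective
  refine le_antisymm (sInf_le ⟨1, dadLE_one_of_isHeight hφ hfree hn, rfl⟩) (le_sInf ?_)
  rintro _ ⟨d, hd, rfl⟩
  have : d ≠ 0 := fun h => not_dadLE_zero_of_zpow_injective ht (h ▸ hd)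
  exact Nat.one_le_cast.mpr <| Nat.one_le_iff_ne_zero.mpr this
end

section
/- Let ℤ act by homeomorphisms on a nonempty compact Hausdorff space X whose covering dimension is finite. If the dynamic asymptotic dimension of the action is finite, then it equals 1. -/
open Pointwise

/-- `b` can be reached from `a` by jumps of length at most `k` whose endpoints lie in `P`. -/
def Reach (k : ℤ) (P : Set ℤ) : ℤ → ℤ → Prop :=
  Relation.ReflTransGen (fun u v => v ∈ P ∧ |v - u| ≤ k)

theorem Reach.mono {k : ℤ} {P Q : Set ℤ} (h : P ⊆ Q) {a b : ℤ} (hab : Reach k P a b) :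
    Reach k Q a b :=
  Relation.ReflTransGen.mono (fun _ _ hv => ⟨h hv.1, hv.2⟩) _ _ hab

theorem Reach.translate {k : ℤ} {P : Set ℤ} {a b : ℤ} (hab : Reach k P a b) (m : ℤ) :
    Reach k {v | v + m ∈ P} (a - m) (b - m) := by
  induction hab with
  | refl => exact Relation.ReflTransGen.refl
  | tail _ h ih =>
    exact Relation.ReflTransGen.tail ih ⟨by simpa using h.1, by simpa using h.2⟩

/-- Jumps of length at most `K` cannot cross a gap of length `K`. -/
theorem Reach.abs_le_of_gaps {K B : ℤ} {P : Set ℤ}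
    (hgap : ∀ a : ℤ, ∃ q, a ≤ q ∧ q ≤ a + B ∧ ∀ v, q ≤ v → v < q + K → v ∉ P)
    {n : ℤ} (h : Reach K P 0 n) : |n| ≤ B := by
  obtain ⟨q, hq1, hq2, hq⟩ := hgap 1
  obtain ⟨r, hr1, hr2, hr⟩ := hgap (-B - K)
  have key : n < q ∧ r + K ≤ n := by
    induction h with
    | refl => constructor <;> omega
    | @tail u v _ huv ih =>
      obtain ⟨hv, huv⟩ := huv
      rw [abs_le] at huv
      constructor
      · by_contra hc
        exact hq v (by omega) (by omega) hv
      · by_contra hc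
        exact hr v (by omega) (by omega) hv
  rw [abs_le]
  constructor <;> omega

theorem exists_continuous_cover {X ι : Type*} [TopologicalSpace X] [CompactSpace X] [T2Space X]
    [Finite ι] {U : ι → Set X} (hU : ∀ i, IsOpen (U i)) (hcov : ⋃ i, U i = Set.univ) :
    ∃ φ : ι → X → NNReal, (∀ i, Continuous (φ i)) ∧ (∀ i x, 0 < φ i x → x ∈ U i) ∧
      ∀ x, ∃ i, 1 ≤ φ i x := by
  obtain ⟨v, hv, -, hvU⟩ := exists_iUnion_eq_closure_subset hU (fun x => Set.toFinite _) hcov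
  have H : ∀ i, ∃ f : C(X, ℝ), Set.EqOn f 0 (U i)ᶜ ∧ Set.EqOn f 1 (closure (v i)) ∧
      ∀ x, f x ∈ Set.Icc (0 : ℝ) 1 := fun i =>
    exists_continuous_zero_one_of_isClosed (hU i).isClosed_compl isClosed_closure
      (Set.disjoint_compl_left_iff_subset.2 (hvU i))
  choose f hf0 hf1 _ using H
  refine ⟨fun i x => (f i x).toNNReal, fun i => continuous_real_toNNReal.comp (f i).continuous,
    fun i x hx => ?_, fun x => ?_⟩
  · by_contra hxU
    simp [hf0 i hxU] at hx
  · obtain ⟨i, hi⟩ := Set.mem_iUnion.1 (hv ▸ Set.mem_univ x)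
    exact ⟨i, by simp [hf1 i (subset_closure hi)]⟩

theorem exists_int_norm_addCircle_le (R : ℤ) (hR : 0 < R) (c : ℝ) :
    ∃ q : ℤ, |q| ≤ R ∧ ∀ e : ℤ, ‖((c - (q + e : ℤ) : ℝ) : AddCircle (R : ℝ))‖ ≤ |e| + 1 := by
  have hR' : (0 : ℝ) < R := by exact_mod_cast hR
  set z : ℤ := round ((R : ℝ)⁻¹ * c)
  have hz : |c - z * R| ≤ R / 2 := by
    have h1 := abs_sub_round ((R : ℝ)⁻¹ * c)
    have h2 : c - z * R = R * ((R : ℝ)⁻¹ * c - z) := by field_simp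
    rw [h2, abs_mul, abs_of_pos hR']
    nlinarith
  set q : ℤ := round (c - z * R)
  have hq : |(c - z * R) - q| ≤ 1 / 2 := abs_sub_round _
  refine ⟨q, ?_, fun e => ?_⟩
  · have h1 : |(q : ℝ)| < R + 1 := by
      rw [abs_le] at hz hq
      rw [abs_lt]
      constructor <;> linarith
    have h2 : |q| < R + 1 := by exact_mod_cast h1
    omega
  · have h1 : ((c - (q + e : ℤ) : ℝ) : AddCircle (R : ℝ)) =
        (((c - z * R) - q - e : ℝ) : AddCircle (R : ℝ)) := by
      rw [← sub_eq_zero, ← AddCircle.coe_sub, AddCircle.coe_eq_zero_iff]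
      exact ⟨z, by push_cast; simp only [zsmul_eq_mul]; ring⟩
    rw [h1]
    calc ‖(((c - z * R) - q - e : ℝ) : AddCircle (R : ℝ))‖
        ≤ ‖((c - z * R) - q - e : ℝ)‖ := QuotientAddGroup.norm_mk_le_norm
      _ ≤ |(c - z * R) - q| + |(e : ℝ)| := abs_sub _ _
      _ ≤ |e| + 1 := by push_cast; linarith

theorem le_norm_addCircle_mul {a s D : ℤ} (ha : 0 < a) (hs : ¬ D ∣ s) :
    (a : ℝ) ≤ ‖(((a * s : ℤ) : ℝ) : AddCircle ((a * D : ℤ) : ℝ))‖ := by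
  rw [AddCircle.norm_eq]
  generalize round ((((a * D : ℤ) : ℝ))⁻¹ * ((a * s : ℤ) : ℝ)) = z
  have h1 : 1 ≤ |s - z * D| := by
    refine Int.one_le_abs fun h0 => hs ⟨z, ?_⟩
    linarith
  have h2 : ((a * s : ℤ) : ℝ) - z * ((a * D : ℤ) : ℝ) = ((a * (s - z * D) : ℤ) : ℝ) := by
    push_cast
    ring
  rw [h2, ← Int.cast_abs, Int.cast_le, abs_mul, abs_of_pos ha]
  nlinarith

section IntAction

variable {X : Type*} [MulAction (Multiplicative ℤ) X]

/-- The action of an integer, written additively. -/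
def shift (n : ℤ) (x : X) : X := Multiplicative.ofAdd n • x

@[simp]
theorem shift_zero (x : X) : shift 0 x = x := by simp [shift]

theorem shift_shift (a b : ℤ) (x : X) : shift a (shift b x) = shift (a + b) x := by
  simp [shift, ofAdd_add, mul_smul]

theorem continuous_shift [TopologicalSpace X] [ContinuousConstSMul (Multiplicative ℤ) X] (n : ℤ) :
    Continuous (shift n : X → X) :=
  continuous_const_smul _

/-- The integers that move `x` into `U`. -/
def visits (U : Set X) (x : X) : Set ℤ := {v | shift v x ∈ U}

theorem mem_dynF_of_reach {k : ℤ} (hk : 0 ≤ k) {U : Set X} {x : X} (hx : x ∈ U) {n : ℤ}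
    (h : Reach k (visits U x) 0 n) :
    Multiplicative.ofAdd n ∈
      dynF U (((Finset.Icc (-k) k).image Multiplicative.ofAdd : Finset (Multiplicative ℤ)) :
        Set (Multiplicative ℤ)) := by
  have hmem : ∀ e : ℤ, |e| ≤ k → Multiplicative.ofAdd e ∈
      (((Finset.Icc (-k) k).image Multiplicative.ofAdd : Finset (Multiplicative ℤ)) :
        Set (Multiplicative ℤ)) := by
    intro e he
    simpa [abs_le] using he
  suffices H : ∃ L : List (Multiplicative ℤ), L ≠ [] ∧
      (∀ h ∈ L, h ∈ (((Finset.Icc (-k) k).image Multiplicative.ofAdd :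
        Finset (Multiplicative ℤ)) : Set (Multiplicative ℤ))) ∧
      Multiplicative.ofAdd n = L.reverse.prod ∧
      ∀ j : ℕ, 1 ≤ j → j ≤ L.length → (L.take j).reverse.prod • x ∈ U by
    obtain ⟨L, hL, hLE, hprod, hLU⟩ := H
    exact ⟨L, hL, hLE, hprod, x, hx, hLU⟩
  induction h with
  | refl =>
    refine ⟨[Multiplicative.ofAdd 0], by simp, ?_, by simp, ?_⟩
    · intro h hh
      rw [List.mem_singleton.1 hh]
      exact hmem 0 (by simpa using hk)
    · intro j h1 h2
      obtain rfl : j = 1 := by simp at h2; omega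
      simpa using hx
  | @tail u v _ huv ih =>
    obtain ⟨L, hL, hLE, hprod, hLU⟩ := ih
    have hv : Multiplicative.ofAdd v = (L ++ [Multiplicative.ofAdd (v - u)]).reverse.prod := by
      simp [← hprod]
    refine ⟨L ++ [Multiplicative.ofAdd (v - u)], by simp, ?_, hv, ?_⟩
    · intro h hh
      rcases List.mem_append.1 hh with hh | hh
      · exact hLE h hh
      · rw [List.mem_singleton.1 hh]
        exact hmem _ huv.2
    · intro j h1 h2
      rcases Nat.lt_or_ge L.length j with hj | hj
      · rw [List.take_of_length_le (by simpa using hj), ← hv]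
        exact huv.1
      · rw [List.take_append_of_le_length hj]
        exact hLU j h1 hj

theorem finite_dynF_of_reach {K B : ℤ} {E : Finset (Multiplicative ℤ)}
    (hE : ∀ e ∈ E, |Multiplicative.toAdd e| ≤ K) {U : Set X}
    (h : ∀ x ∈ U, ∀ n, Reach K (visits U x) 0 n → |n| ≤ B) :
    (dynF U (E : Set (Multiplicative ℤ))).Finite := by
  refine Set.Finite.subset ((Finset.Icc (-B) B).image Multiplicative.ofAdd).finite_toSet ?_
  rintro g ⟨L, -, hLE, rfl, x, hx, hL⟩
  have key : ∀ j ≤ L.length,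
      Reach K (visits U x) 0 (Multiplicative.toAdd (L.take j).reverse.prod) := by
    intro j
    induction j with
    | zero => exact fun _ => Relation.ReflTransGen.refl
    | succ j ih =>
      intro hj
      refine Relation.ReflTransGen.tail (ih (by omega)) ⟨hL (j + 1) (by omega) hj, ?_⟩
      have hj' : j < L.length := by omega
      rw [List.take_succ_eq_append_getElem hj']
      rw [List.reverse_append, List.prod_append]
      simpa only [List.reverse_singleton, List.prod_singleton, toAdd_mul, add_sub_cancel_right]
        using hE _ (hLE _ (List.getElem_mem hj'))
  have h1 := h x hx _ (key L.length le_rfl)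
  rw [List.take_length] at h1
  rw [abs_le] at h1
  simp only [Finset.coe_image, Set.mem_image, Finset.mem_coe, Finset.mem_Icc]
  exact ⟨_, h1, rfl⟩

open Classical in
/-- The largest level `t` such that `n` is reachable from `0` along the orbit of `x` by jumps of
length at most `k` inside `{t < φ}`, where only positions in `[-M, M]` are used. -/
noncomputable def bottleneck (φ : X → NNReal) (k M n : ℤ) (x : X) : NNReal :=
  ((Finset.Icc (-M) M).powerset.filter (fun S : Finset ℤ => Reach k (S : Set ℤ) 0 n)).sup
    (fun S => (insert 0 S).inf' (Finset.insert_nonempty 0 S) (fun s => φ (shift s x)))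

theorem continuous_bottleneck [TopologicalSpace X] [ContinuousConstSMul (Multiplicative ℤ) X]
    {φ : X → NNReal} (hφ : Continuous φ) (k M n : ℤ) : Continuous (bottleneck φ k M n) := by
  unfold bottleneck
  refine Continuous.finset_sup_apply fun S _ => ?_
  exact Continuous.finset_inf'_apply _ fun s _ => hφ.comp (continuous_shift s)

theorem lt_bottleneck_iff {φ : X → NNReal} {k M : ℤ}
    (hφM : ∀ x, 0 < φ x → ∀ n, Reach k (visits {y | 0 < φ y} x) 0 n → |n| ≤ M)
    {n : ℤ} {x : X} {t : NNReal} :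
    t < bottleneck φ k M n x ↔ t < φ x ∧ Reach k (visits {y | t < φ y} x) 0 n := by
  classical
  unfold bottleneck
  rw [Finset.lt_sup_iff]
  constructor
  · rintro ⟨S, hS, ht⟩
    rw [Finset.lt_inf'_iff] at ht
    refine ⟨by simpa using ht 0 (Finset.mem_insert_self 0 S), ?_⟩
    exact (Finset.mem_filter.1 hS).2.mono fun s hs => ht s (Finset.mem_insert_of_mem hs)
  · rintro ⟨hx, hn⟩
    refine ⟨(Finset.Icc (-M) M).filter (fun s => t < φ (shift s x)), ?_, ?_⟩
    · refine Finset.mem_filter.2 ⟨by simp, ?_⟩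
      induction hn with
      | refl => exact Relation.ReflTransGen.refl
      | @tail u v hu huv ih =>
        refine Relation.ReflTransGen.tail ih ⟨?_, huv.2⟩
        have hv : |v| ≤ M := by
          refine hφM x (pos_of_gt hx) v (Reach.mono ?_ (Relation.ReflTransGen.tail hu huv))
          intro s hs
          exact pos_of_gt (show t < φ (shift s x) from hs)
        rw [abs_le] at hv
        simpa [hv, visits] using huv.1
    · rw [Finset.lt_inf'_iff]
      intro s hs
      rcases Finset.mem_insert.1 hs with rfl | hs
      · simpa using hx
      · exact (Finset.mem_filter.1 hs).2

theorem Reach.visits_shift {k : ℤ} {U : Set X} {x : X} {m n : ℤ} (hm : |m| ≤ k) (hx : x ∈ U)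
    (h : Reach k (visits U x) 0 n) : Reach k (visits U (shift m x)) 0 (n - m) := by
  have h' : Reach k (visits U x) m n :=
    Relation.ReflTransGen.head ⟨by simpa [visits] using hx, by simpa using hm⟩ h
  have := h'.translate m
  simpa [visits, shift_shift] using this

theorem min_bottleneck_shift {φ : X → NNReal} {k M : ℤ}
    (hφM : ∀ x, 0 < φ x → ∀ n, Reach k (visits {y | 0 < φ y} x) 0 n → |n| ≤ M)
    {a : NNReal} {x : X} {m : ℤ} (hm : |m| ≤ k) (hx : a < φ x) (hmx : a < φ (shift m x)) (n : ℤ) :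
    min a (bottleneck φ k M n (shift m x)) = min a (bottleneck φ k M (n + m) x) := by
  refine eq_of_forall_lt_iff fun t => ?_
  rw [lt_min_iff, lt_min_iff, lt_bottleneck_iff hφM, lt_bottleneck_iff hφM]
  refine and_congr_right fun ht => ?_
  have hx' := ht.trans hx
  have hmx' := ht.trans hmx
  simp only [hx', hmx', true_and]
  constructor
  · intro h
    have := h.visits_shift (U := {y | t < φ y}) (m := -m) (by simpa using hm) hmx'
    simpa [shift_shift] using this
  · intro h
    simpa using h.visits_shift (U := {y | t < φ y}) hm hx'

/-- A continuous choice of a center for every cluster of `{1 / 2 < φ}` along an orbit, at a position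
that may fail to be an integer. -/
theorem exists_center [TopologicalSpace X] [ContinuousConstSMul (Multiplicative ℤ) X]
    {φ : X → NNReal} (hφ : Continuous φ) {k M : ℤ}
    (hφM : ∀ x, 0 < φ x → ∀ n, Reach k (visits {y | 0 < φ y} x) 0 n → |n| ≤ M) :
    ∃ c : X → ℝ, ContinuousOn c {y | 1 / 2 < φ y} ∧
      ∀ x m, |m| ≤ k → 1 / 2 < φ x → 1 / 2 < φ (shift m x) → c (shift m x) = c x - m := by
  let χ : ℤ → X → ℝ := fun n x => (min (1 / 2) (bottleneck φ k M n x) : NNReal)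
  have hχc : ∀ n, Continuous (χ n) := fun n =>
    NNReal.continuous_coe.comp (continuous_const.min (continuous_bottleneck hφ k M n))
  have hχ0 : ∀ n x, 0 ≤ χ n x := fun n x => NNReal.coe_nonneg _
  have hsupp : ∀ n x, χ n x ≠ 0 → n ∈ Finset.Icc (-M) M := by
    intro n x h
    have h1 : 0 < bottleneck φ k M n x := by
      rw [pos_iff_ne_zero]
      intro h0
      simp [χ, h0] at h
    rw [lt_bottleneck_iff hφM] at h1
    simpa [abs_le] using hφM x h1.1 n h1.2
  have hfin : ∀ x (f : ℤ → ℝ), (Function.support fun n => f n * χ n x) ⊆ Finset.Icc (-M) M := by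
    intro x f n hn
    exact hsupp n x (right_ne_zero_of_mul hn)
  have hfin' : ∀ x (f : ℤ → ℝ), (Function.support fun n => f n * χ n x).Finite := fun x f =>
    (Finset.finite_toSet _).subset (hfin x f)
  have hcont : ∀ f : ℤ → ℝ, Continuous fun x => ∑ᶠ n, f n * χ n x := by
    intro f
    simp_rw [fun x => finsum_eq_sum_of_support_subset _ (hfin x f)]
    exact continuous_finsetSum _ fun n _ => continuous_const.mul (hχc n)
  have hpos : ∀ x, 1 / 2 < φ x → 0 < ∑ᶠ n, (1 : ℝ) * χ n x := by
    intro x hx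
    refine finsum_pos (fun n => mul_nonneg zero_le_one (hχ0 n x)) ⟨0, ?_⟩ (hfin' x fun _ => 1)
    have : 0 < bottleneck φ k M 0 x :=
      (lt_bottleneck_iff hφM).2 ⟨pos_of_gt hx, Relation.ReflTransGen.refl⟩
    simpa [χ] using this
  refine ⟨fun x => (∑ᶠ n : ℤ, (n : ℝ) * χ n x) / ∑ᶠ n : ℤ, (1 : ℝ) * χ n x, ?_, ?_⟩
  · exact (hcont _).continuousOn.div (hcont fun _ => 1).continuousOn fun x hx => (hpos x hx).ne'
  · intro x m hm hx hmx
    have hshift : ∀ f : ℤ → ℝ,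
        ∑ᶠ n, f n * χ n (shift m x) = ∑ᶠ n, f (n - m) * χ n x := by
      intro f
      rw [← finsum_comp_equiv (Equiv.addRight m) (f := fun n => f (n - m) * χ n x)]
      refine finsum_congr fun n => ?_
      simp only [χ, Equiv.coe_addRight, add_sub_cancel_right]
      rw [min_bottleneck_shift hφM hm hx hmx]
    have hsub : ∑ᶠ n : ℤ, ((n - m : ℤ) : ℝ) * χ n x =
        (∑ᶠ n : ℤ, (n : ℝ) * χ n x) - m * ∑ᶠ n : ℤ, (1 : ℝ) * χ n x := by
      rw [mul_finsum, ← finsum_sub_distrib (hfin' x _)]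
      · refine finsum_congr fun n => ?_
        push_cast
        ring
      · simp_rw [one_mul]
        exact hfin' x fun _ => (m : ℝ)
    simp only [hshift, hsub]
    rw [sub_div, mul_div_assoc, div_self (hpos x hx).ne', mul_one]

theorem DadLE.exists_centers [TopologicalSpace X] [CompactSpace X] [T2Space X]
    [ContinuousConstSMul (Multiplicative ℤ) X] {d : ℕ} (h : DadLE (Multiplicative ℤ) X d) {k : ℤ}
    (hk : 0 ≤ k) :
    ∃ (V C : Fin (d + 1) → Set X) (c : Fin (d + 1) → X → ℝ), (∀ i, IsOpen (V i)) ∧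
      (∀ i, IsClosed (C i)) ∧ (∀ i, C i ⊆ V i) ∧ (∀ x, ∃ i, x ∈ C i) ∧
      (∀ i, ContinuousOn (c i) (V i)) ∧
      ∀ i x m, |m| ≤ k → x ∈ V i → shift m x ∈ V i → c i (shift m x) = c i x - m := by
  obtain ⟨U, hU, hcov, hfin⟩ := h ((Finset.Icc (-k) k).image Multiplicative.ofAdd)
  obtain ⟨φ, hφ, hφU, hφ1⟩ := exists_continuous_cover hU hcov
  have H : ∀ i, ∃ c : X → ℝ, ContinuousOn c {y | 1 / 2 < φ i y} ∧
      ∀ x m, |m| ≤ k → 1 / 2 < φ i x → 1 / 2 < φ i (shift m x) → c (shift m x) = c x - m := by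
    intro i
    obtain ⟨M, hM⟩ := ((hfin i).image fun g => |Multiplicative.toAdd g|).bddAbove
    refine exists_center (hφ i) (M := M) fun x hx n hn => ?_
    exact hM ⟨_, mem_dynF_of_reach hk (hφU i x hx) (hn.mono fun s hs => hφU i _ hs), rfl⟩
  choose c hc hcm using H
  refine ⟨fun i => {y | 1 / 2 < φ i y}, fun i => {y | 1 ≤ φ i y}, c,
    fun i => isOpen_lt continuous_const (hφ i), fun i => isClosed_le continuous_const (hφ i),
    fun i x hx => ?_, hφ1, hc, hcm⟩
  exact lt_of_lt_of_le (half_lt_self one_pos) (show 1 ≤ φ i x from hx)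

/-- Marking, near each cluster, the positions at distance a multiple of `R` from its center yields
an open set with bounded gaps whose complement can be enlarged to an open set with bounded gaps. -/
theorem DadLE.one [TopologicalSpace X] [CompactSpace X] [T2Space X]
    [ContinuousConstSMul (Multiplicative ℤ) X] {d : ℕ} (h : DadLE (Multiplicative ℤ) X d) :
    DadLE (Multiplicative ℤ) X 1 := by
  intro E
  obtain ⟨K, hK1, hEK⟩ : ∃ K : ℤ, 1 ≤ K ∧ ∀ e ∈ E, |Multiplicative.toAdd e| ≤ K := by
    obtain ⟨K, hK⟩ := (E.finite_toSet.image fun g => |Multiplicative.toAdd g|).bddAbove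
    exact ⟨max K 1, le_max_right _ _, fun e he => (hK ⟨e, he, rfl⟩).trans (le_max_left _ _)⟩
  obtain ⟨R, hR⟩ : ∃ R : ℤ, R = 8 * K * (d + 2 : ℤ) := ⟨_, rfl⟩
  have hKR : 16 * K ≤ R := by rw [hR]; nlinarith
  obtain ⟨V, C, c, hV, hC, hCV, hcov, hc, hcm⟩ := h.exists_centers (k := 5 * R) (by omega)
  let A : Fin (d + 1) → ℤ → Set X := fun i n =>
    V i ∩ {y | ‖((c i y + n : ℝ) : AddCircle (R : ℝ))‖ < K + 2}
  let B : Fin (d + 1) → ℤ → Set X := fun i n =>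
    C i ∩ {y | ‖((c i y + n : ℝ) : AddCircle (R : ℝ))‖ ≤ K + 1}
  have hcn : ∀ i (n : ℤ), ContinuousOn
      (fun y => ‖((c i y + n : ℝ) : AddCircle (R : ℝ))‖) (V i) := fun i n =>
    (continuous_norm.comp (AddCircle.continuous_mk' (R : ℝ))).comp_continuousOn
      ((hc i).add continuousOn_const)
  have hA : ∀ i n, IsOpen (A i n) := fun i n => (hcn i n).isOpen_inter_preimage (hV i) isOpen_Iio
  have hB : ∀ i n, IsClosed (B i n) := fun i n =>
    ((hcn i n).mono (hCV i)).preimage_isClosed_of_isClosed (hC i) isClosed_Iic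
  have hBA : ∀ i n, B i n ⊆ A i n := fun i n y hy =>
    ⟨hCV i hy.1, lt_of_le_of_lt (b := (K : ℝ) + 1) hy.2 (by linarith)⟩
  let W : Set X := ⋃ i, ⋃ n ∈ Finset.Icc (-(2 * R)) (2 * R), shift n ⁻¹' A i n
  let D : Set X := ⋃ i, ⋃ n ∈ Finset.Icc (-(2 * R)) (2 * R), shift n ⁻¹' B i n
  have hW : IsOpen W := isOpen_iUnion fun i => isOpen_biUnion fun n _ =>
    (hA i n).preimage (continuous_shift n)
  have hD : IsClosed D := isClosed_iUnion_of_finite fun i => isClosed_biUnion_finset fun n _ =>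
    (hB i n).preimage (continuous_shift n)
  have hDW : D ⊆ W := Set.iUnion_mono fun i => Set.iUnion₂_mono fun n _ =>
    Set.preimage_mono (hBA i n)
  have hgapD : ∀ x (a : ℤ), ∃ q, a ≤ q ∧ q ≤ a + 2 * R ∧
      ∀ v, q ≤ v → v < q + K → v ∉ visits Dᶜ x := by
    intro x a
    obtain ⟨i, hi⟩ := hcov (shift (a + R) x)
    obtain ⟨q, hq, hqe⟩ := exists_int_norm_addCircle_le R (by omega) (c i (shift (a + R) x))
    rw [abs_le] at hq
    refine ⟨a + R + q, by omega, by omega, fun v hv1 hv2 hv => hv ?_⟩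
    refine Set.mem_iUnion.2 ⟨i, Set.mem_iUnion₂.2 ⟨a + R - v, ?_, ?_⟩⟩
    · rw [Finset.mem_Icc]
      constructor <;> omega
    · have he := hqe (v - (a + R + q))
      have hshift : shift (a + R - v) (shift v x) = shift (a + R) x := by simp [shift_shift]
      change shift (a + R - v) (shift v x) ∈ B i (a + R - v)
      rw [hshift]
      refine ⟨hi, ?_⟩
      have h1 : c i (shift (a + R) x) - ((q + (v - (a + R + q)) : ℤ) : ℝ) =
          c i (shift (a + R) x) + ((a + R - v : ℤ) : ℝ) := by
        push_cast
        ring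
      rw [h1] at he
      refine he.trans ?_
      have h2 : |v - (a + R + q)| ≤ K := by
        rw [abs_le]
        constructor <;> omega
      have h3 : ((|v - (a + R + q)| : ℤ) : ℝ) ≤ K := by exact_mod_cast h2
      linarith
  have hgapW : ∀ x (a : ℤ), ∃ q, a ≤ q ∧ q ≤ a + R ∧
      ∀ v, q ≤ v → v < q + K → v ∉ visits W x := by
    intro x a
    by_contra! hcon
    have H : ∀ j : Fin (d + 2), ∃ (v n : ℤ) (i : Fin (d + 1)), a + 8 * K * (j : ℕ) ≤ v ∧
        v < a + 8 * K * (j : ℕ) + K ∧ |n| ≤ 2 * R ∧ shift (n + v) x ∈ A i n := by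
      intro j
      have hj : ((j : ℕ) : ℤ) < d + 2 := by exact_mod_cast j.2
      have hj0 : (0 : ℤ) ≤ ((j : ℕ) : ℤ) := Int.natCast_nonneg _
      obtain ⟨v, hv1, hv2, hv⟩ := hcon (a + 8 * K * (j : ℕ)) (by nlinarith) (by rw [hR]; nlinarith)
      obtain ⟨i, hi⟩ := Set.mem_iUnion.1 hv
      obtain ⟨n, hn, hin⟩ := Set.mem_iUnion₂.1 hi
      refine ⟨v, n, i, hv1, hv2, abs_le.2 (Finset.mem_Icc.1 hn), ?_⟩
      rw [← shift_shift]
      exact hin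
    choose v n i hv1 hv2 hn hA' using H
    obtain ⟨j, l, hjl, hij⟩ : ∃ j l, j ≠ l ∧ i j = i l :=
      Fintype.exists_ne_map_eq_of_card_lt i (by simp)
    have hb : ∀ j : Fin (d + 2), a ≤ v j ∧ v j ≤ a + R := by
      intro j
      have hj : ((j : ℕ) : ℤ) + 1 ≤ d + 2 := by exact_mod_cast j.2
      have h0 := hv1 j
      have h1 := hv2 j
      constructor
      · nlinarith [Int.natCast_nonneg (j : ℕ)]
      · rw [hR]; nlinarith
    have hj := hA' j
    have hl := hA' l
    rw [← hij] at hl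
    have hcl := hcm (i j) (shift (n j + v j) x) ((n l + v l) - (n j + v j))
      (by
        have h1 := hn j
        have h2 := hn l
        have h3 := hb j
        have h4 := hb l
        rw [abs_le] at *
        constructor <;> omega) hj.1 (by simpa [shift_shift] using hl.1)
    have hsh : shift ((n l + v l) - (n j + v j)) (shift (n j + v j) x) = shift (n l + v l) x := by
      simp [shift_shift]
    rw [hsh] at hcl
    have hj2 := hj.2
    have hl2 := hl.2
    simp only [Set.mem_ofPred_eq] at hj2 hl2
    rw [hcl] at hl2
    have hvv : ‖(((v l - v j : ℤ) : ℝ) : AddCircle (R : ℝ))‖ < 2 * K + 4 := by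
      refine lt_of_le_of_lt ?_ (by linarith : _ < (2 * K + 4 : ℝ))
        (b := ‖((c (i j) (shift (n j + v j) x) + n j : ℝ) : AddCircle (R : ℝ))‖ +
          ‖((c (i j) (shift (n j + v j) x) - ((n l + v l - (n j + v j) : ℤ) : ℝ) + n l : ℝ) :
            AddCircle (R : ℝ))‖)
      refine le_of_eq_of_le ?_ (norm_sub_le _ _)
      rw [← AddCircle.coe_sub]
      congr 2
      push_cast
      ring
    have hD : ¬ ((d : ℤ) + 2) ∣ ((l : ℕ) : ℤ) - ((j : ℕ) : ℤ) := by
      intro hdvd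
      have h1 := Int.eq_zero_of_abs_lt_dvd hdvd (by rw [abs_lt]; constructor <;> omega)
      exact hjl (Fin.ext (by omega))
    have h8 := le_norm_addCircle_mul (a := 8 * K) (by omega) hD
    rw [← hR] at h8
    set e : ℤ := (v l - v j) - 8 * K * (((l : ℕ) : ℤ) - ((j : ℕ) : ℤ)) with he
    have he' : |e| ≤ K := by
      have h1 := hv1 j
      have h2 := hv2 j
      have h3 := hv1 l
      have h4 := hv2 l
      rw [abs_le]
      constructor <;> linarith
    have h9 : ‖(((8 * K * (((l : ℕ) : ℤ) - ((j : ℕ) : ℤ)) : ℤ) : ℝ) : AddCircle (R : ℝ))‖ ≤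
        ‖(((v l - v j : ℤ) : ℝ) : AddCircle (R : ℝ))‖ + ‖((e : ℝ) : AddCircle (R : ℝ))‖ := by
      refine le_of_eq_of_le ?_ (norm_sub_le _ _)
      rw [← AddCircle.coe_sub, he]
      congr 2
      push_cast
      ring
    have h10 : ‖((e : ℝ) : AddCircle (R : ℝ))‖ ≤ K := by
      refine (QuotientAddGroup.norm_mk_le_norm).trans ?_
      rw [Real.norm_eq_abs]
      exact_mod_cast he'
    have hK : (1 : ℝ) ≤ K := by exact_mod_cast hK1
    push_cast at h8 h9 hvv
    linarith
  refine ⟨![W, Dᶜ], ?_, ?_, ?_⟩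
  · intro i
    fin_cases i
    · exact hW
    · exact hD.isOpen_compl
  · rw [Set.eq_univ_iff_forall]
    intro x
    by_cases hx : x ∈ D
    · exact Set.mem_iUnion.2 ⟨0, hDW hx⟩
    · exact Set.mem_iUnion.2 ⟨1, hx⟩
  · intro i
    fin_cases i
    · exact finite_dynF_of_reach hEK fun x _ n hn => hn.abs_le_of_gaps (hgapW x)
    · exact finite_dynF_of_reach hEK fun x _ n hn => hn.abs_le_of_gaps (hgapD x)

theorem not_dadLE_zero [TopologicalSpace X] [Nonempty X] : ¬ DadLE (Multiplicative ℤ) X 0 := by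
  intro h
  obtain ⟨U, -, hcov, hfin⟩ := h ((Finset.Icc (-1) 1).image Multiplicative.ofAdd)
  have hU : U 0 = Set.univ := by
    rw [← hcov]
    exact (Set.iUnion_eq_const fun i => by fin_cases i; rfl).symm
  obtain ⟨x⟩ := ‹Nonempty X›
  refine Set.infinite_of_injective_forall_mem (f := fun n : ℕ => Multiplicative.ofAdd (n : ℤ))
    (fun a b hab => by simpa using hab) (fun n => ?_) (hfin 0)
  refine mem_dynF_of_reach zero_le_one (x := x) (by simp [hU]) ?_
  induction n with
  | zero => exact Relation.ReflTransGen.refl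
  | succ n ih => exact Relation.ReflTransGen.tail ih ⟨by simp [visits, hU], by simp⟩

end IntAction

/-- For an action of `ℤ` on a nonempty compact Hausdorff space of finite
covering dimension, finiteness of the dynamic asymptotic dimension implies that it
equals 1. -/
theorem dad_eq_one_of_int_finite_dad
    (X : Type*) [TopologicalSpace X] [CompactSpace X] [T2Space X] [Nonempty X]
    [MulAction (Multiplicative ℤ) X] [ContinuousConstSMul (Multiplicative ℤ) X]
    (hdim : ∃ n : ℕ, CovDimLE X n)
    (hfin : dad (Multiplicative ℤ) X ≠ ⊤) :
    dad (Multiplicative ℤ) X = 1 := by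
  obtain ⟨d, hd⟩ : ∃ d, DadLE (Multiplicative ℤ) X d := by
    by_contra! hcon
    exact hfin (by simp [dad, hcon])
  refine le_antisymm (sInf_le ⟨1, hd.one, by simp⟩) (le_sInf ?_)
  rintro _ ⟨e, he, rfl⟩
  have he0 : e ≠ 0 := by
    rintro rfl
    exact not_dadLE_zero he
  exact Nat.one_le_cast.2 (Nat.one_le_iff_ne_zero.2 he0)
end
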